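/- arXiv:2307.12818 — 2 statements merged into one kernel-verified Lean document; each statement's English description precedes it below -/
import Mathlib

section
/- The anisotropic second-order Arakawa approximation J1 of the Poisson bracket is second-order accurate: for infinitely differentiable functions f, g : ℝ × ℝ → ℝ and a point (x,y) ∈ ℝ², there exist constants C > 0 and ε > 0 such that for all spacings Δx, Δy with 0 < Δx ≤ ε and 0 < Δy ≤ ε, |J1_{Δx,Δy}(f,g)(x,y) − (∂f/∂x·∂g/∂y − ∂f/∂y·∂g/∂x)(x,y)| ≤ C·(Δx² + Δy²). -/
noncomputable def J1pp (dx dy : ℝ) (f g : ℝ × ℝ → ℝ) (x y : ℝ) : ℝ :=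
  (1 / (4 * dx * dy)) *
    ((f (x + dx, y) - f (x - dx, y)) * (g (x, y + dy) - g (x, y - dy)) -
      (f (x, y + dy) - f (x, y - dy)) * (g (x + dx, y) - g (x - dx, y)))

noncomputable def J1px (dx dy : ℝ) (f g : ℝ × ℝ → ℝ) (x y : ℝ) : ℝ :=
  (1 / (4 * dx * dy)) *
    (f (x + dx, y) * (g (x + dx, y + dy) - g (x + dx, y - dy)) -
      f (x - dx, y) * (g (x - dx, y + dy) - g (x - dx, y - dy)) -
      f (x, y + dy) * (g (x + dx, y + dy) - g (x - dx, y + dy)) +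
      f (x, y - dy) * (g (x + dx, y - dy) - g (x - dx, y - dy)))

noncomputable def J1xp (dx dy : ℝ) (f g : ℝ × ℝ → ℝ) (x y : ℝ) : ℝ :=
  (1 / (4 * dx * dy)) *
    (f (x + dx, y + dy) * (g (x, y + dy) - g (x + dx, y)) -
      f (x - dx, y - dy) * (g (x - dx, y) - g (x, y - dy)) -
      f (x - dx, y + dy) * (g (x, y + dy) - g (x - dx, y)) +
      f (x + dx, y - dy) * (g (x + dx, y) - g (x, y - dy)))

/-- The anisotropic second-order Arakawa approximation of the Poisson bracket. -/
noncomputable def J1 (dx dy : ℝ) (f g : ℝ × ℝ → ℝ) (x y : ℝ) : ℝ :=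
  (1 / 3) * (J1pp dx dy f g x y + J1px dx dy f g x y + J1xp dx dy f g x y)

/-- The partial derivative of `F` in the first variable. -/
noncomputable def partialFst (F : ℝ × ℝ → ℝ) (p : ℝ × ℝ) : ℝ := fderiv ℝ F p (1, 0)

/-- The partial derivative of `F` in the second variable. -/
noncomputable def partialSnd (F : ℝ × ℝ → ℝ) (p : ℝ × ℝ) : ℝ := fderiv ℝ F p (0, 1)

theorem ContDiff.partialFst {F : ℝ × ℝ → ℝ} (hF : ContDiff ℝ (⊤ : ℕ∞) F) :
    ContDiff ℝ (⊤ : ℕ∞) (partialFst F) :=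
  (hF.fderiv_right (m := (⊤ : ℕ∞)) (by simp)).clm_apply contDiff_const

theorem ContDiff.partialSnd {F : ℝ × ℝ → ℝ} (hF : ContDiff ℝ (⊤ : ℕ∞) F) :
    ContDiff ℝ (⊤ : ℕ∞) (partialSnd F) :=
  (hF.fderiv_right (m := (⊤ : ℕ∞)) (by simp)).clm_apply contDiff_const

theorem ContDiff.hasDerivAt_partialFst {F : ℝ × ℝ → ℝ} (hF : ContDiff ℝ (⊤ : ℕ∞) F)
    (h k : ℝ) : HasDerivAt (fun t => F (t, k)) (_root_.partialFst F (h, k)) h :=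
  ((hF.differentiable (by simp)) (h, k)).hasFDerivAt.comp_hasDerivAt h
    ((hasDerivAt_id h).prodMk (hasDerivAt_const h k))

theorem ContDiff.hasDerivAt_partialSnd {F : ℝ × ℝ → ℝ} (hF : ContDiff ℝ (⊤ : ℕ∞) F)
    (h k : ℝ) : HasDerivAt (fun t => F (h, t)) (_root_.partialSnd F (h, k)) k :=
  ((hF.differentiable (by simp)) (h, k)).hasFDerivAt.comp_hasDerivAt k
    ((hasDerivAt_const k h).prodMk (hasDerivAt_id k))

theorem abs_le_mul_pow_succ_of_hasDerivAt {φ φ' : ℝ → ℝ} (hφ : ∀ t, HasDerivAt φ (φ' t) t)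
    (h0 : φ 0 = 0) {M a : ℝ} (hM : 0 ≤ M) {n : ℕ}
    (hb : ∀ t, 0 ≤ t → t ≤ a → |φ' t| ≤ M * t ^ n) (t : ℝ) (ht : 0 ≤ t) (hta : t ≤ a) :
    |φ t| ≤ M * t ^ (n + 1) := by
  have key := (convex_Icc (0 : ℝ) t).norm_image_sub_le_of_norm_hasDerivWithin_le
    (f := φ) (f' := φ') (C := M * t ^ n) (x := 0) (y := t)
    (fun s _ => (hφ s).hasDerivWithinAt)
    (fun s hs => (hb s hs.1 (hs.2.trans hta)).trans
      (mul_le_mul_of_nonneg_left (pow_le_pow_left₀ hs.1 hs.2 n) hM))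
    ⟨le_rfl, ht⟩ ⟨ht, le_rfl⟩
  simpa [h0, abs_of_nonneg ht, pow_succ, mul_assoc] using key

theorem HasDerivAt.even_of_odd {φ φ' : ℝ → ℝ} (hφ : ∀ t, HasDerivAt φ (φ' t) t)
    (h : ∀ t, φ (-t) = -φ t) (t : ℝ) : φ' (-t) = φ' t := by
  have h1 : HasDerivAt (fun s => φ (-s)) (-φ' (-t)) t := by
    simpa [Function.comp_def] using (hφ (-t)).comp t (hasDerivAt_neg t)
  have h2 : HasDerivAt (fun s => φ (-s)) (-φ' t) t := by
    simpa only [h] using (hφ t).fun_neg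
  linarith [h1.unique h2]

theorem HasDerivAt.odd_of_even {φ φ' : ℝ → ℝ} (hφ : ∀ t, HasDerivAt φ (φ' t) t)
    (h : ∀ t, φ (-t) = φ t) (t : ℝ) : φ' (-t) = -φ' t := by
  have h1 : HasDerivAt (fun s => φ (-s)) (-φ' (-t)) t := by
    simpa [Function.comp_def] using (hφ (-t)).comp t (hasDerivAt_neg t)
  have h2 : HasDerivAt (fun s => φ (-s)) (φ' t) t := by
    simpa only [h] using hφ t
  linarith [h1.unique h2]

theorem abs_sub_mul_le_cube_of_odd {φ φ₁ φ₂ φ₃ : ℝ → ℝ} (h₁ : ∀ t, HasDerivAt φ (φ₁ t) t)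
    (h₂ : ∀ t, HasDerivAt φ₁ (φ₂ t) t) (h₃ : ∀ t, HasDerivAt φ₂ (φ₃ t) t)
    (hodd : ∀ t, φ (-t) = -φ t) {M a : ℝ} (hM : 0 ≤ M)
    (hb : ∀ t, 0 ≤ t → t ≤ a → |φ₃ t| ≤ M) (t : ℝ) (ht : 0 ≤ t) (hta : t ≤ a) :
    |φ t - t * φ₁ 0| ≤ M * t ^ 3 := by
  have z : φ 0 = 0 := by
    have := hodd 0
    rw [neg_zero] at this
    linarith
  have z₂ : φ₂ 0 = 0 := by
    have := HasDerivAt.odd_of_even h₂ (HasDerivAt.even_of_odd h₁ hodd) 0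
    rw [neg_zero] at this
    linarith
  have b₂ := abs_le_mul_pow_succ_of_hasDerivAt h₃ z₂ hM (n := 0) (a := a) (by simpa using hb)
  have b₁ := abs_le_mul_pow_succ_of_hasDerivAt (φ := fun t => φ₁ t - φ₁ 0)
    (fun t => (h₂ t).sub_const _) (by simp) hM b₂
  have d₀ : ∀ t, HasDerivAt (fun t => φ t - t * φ₁ 0) (φ₁ t - φ₁ 0) t := fun t => by
    simpa using (h₁ t).fun_sub ((hasDerivAt_id t).mul_const (φ₁ 0))
  exact abs_le_mul_pow_succ_of_hasDerivAt d₀ (by simp [z]) hM b₁ t ht hta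

theorem partialFst_eq_zero_of_forall {F : ℝ × ℝ → ℝ} (hF : ContDiff ℝ (⊤ : ℕ∞) F) {k : ℝ}
    (h : ∀ t, F (t, k) = 0) (t : ℝ) : partialFst F (t, k) = 0 := by
  have h1 := hF.hasDerivAt_partialFst t k
  simp only [h] at h1
  exact h1.unique (hasDerivAt_const t 0)

theorem exists_bound_on_unit_square {F : ℝ × ℝ → ℝ} (hF : Continuous F) :
    ∃ M > 0, ∀ h k : ℝ, 0 ≤ h → h ≤ 1 → 0 ≤ k → k ≤ 1 → |F (h, k)| ≤ M := by
  obtain ⟨M, hM⟩ := ((isCompact_Icc (a := (0 : ℝ)) (b := 1)).prod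
    (isCompact_Icc (a := (0 : ℝ)) (b := 1))).exists_bound_of_continuousOn hF.continuousOn
  exact ⟨max M 1, by positivity, fun h k h0 h1 k0 k1 =>
    (hM (h, k) ⟨⟨h0, h1⟩, ⟨k0, k1⟩⟩).trans (le_max_left _ _)⟩

/-- A smooth function that is odd in each variable agrees with its mixed second-order term up to
an error that is divisible by the product of the variables. -/
theorem exists_bound_of_odd_odd {F : ℝ × ℝ → ℝ} (hF : ContDiff ℝ (⊤ : ℕ∞) F)
    (hodd₁ : ∀ h k, F (-h, k) = -F (h, k)) (hodd₂ : ∀ h k, F (h, -k) = -F (h, k)) :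
    ∃ C > 0, ∀ h k : ℝ, 0 ≤ h → h ≤ 1 → 0 ≤ k → k ≤ 1 →
      |F (h, k) - h * k * partialSnd (partialFst F) (0, 0)| ≤ C * (h * k * (h ^ 2 + k ^ 2)) := by
  have c₁ := hF.partialFst
  have c₁₁ := c₁.partialFst
  have c₁₁₁ := c₁₁.partialFst
  have c₂ := c₁.partialSnd
  have c₂₂ := c₂.partialSnd
  obtain ⟨M, hM, bM⟩ := exists_bound_on_unit_square c₁₁₁.partialSnd.continuous
  obtain ⟨N, hN, bN⟩ := exists_bound_on_unit_square c₂₂.partialSnd.continuous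
  have z : ∀ h, F (h, 0) = 0 := fun h => by
    have := hodd₂ h 0
    rw [neg_zero] at this
    linarith
  have z₃ := partialFst_eq_zero_of_forall c₁₁
    (partialFst_eq_zero_of_forall c₁ (partialFst_eq_zero_of_forall hF z))
  have odd₁ : ∀ k, partialFst F (0, -k) = -partialFst F (0, k) := fun k => by
    have h1 := hF.hasDerivAt_partialFst 0 (-k)
    simp only [hodd₂] at h1
    exact h1.unique (hF.hasDerivAt_partialFst 0 k).fun_neg
  refine ⟨M + N, by positivity, fun h k h0 h1 k0 k1 => ?_⟩
  have e₁ : |F (h, k) - h * partialFst F (0, k)| ≤ M * k * h ^ 3 := by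
    refine abs_sub_mul_le_cube_of_odd (φ := fun t => F (t, k))
      (φ₁ := fun t => partialFst F (t, k)) (fun t => hF.hasDerivAt_partialFst t k)
      (fun t => c₁.hasDerivAt_partialFst t k) (fun t => c₁₁.hasDerivAt_partialFst t k)
      (fun t => hodd₁ t k) (by positivity) (a := 1) (fun t t0 t1 => ?_) h h0 h1
    have := abs_le_mul_pow_succ_of_hasDerivAt (fun s => c₁₁₁.hasDerivAt_partialSnd t s) (z₃ t)
      hM.le (n := 0) (a := 1) (fun s s0 s1 => by simpa using bM t s t0 t1 s0 s1) k k0 k1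
    simpa using this
  have e₂ : |partialFst F (0, k) - k * partialSnd (partialFst F) (0, 0)| ≤ N * k ^ 3 :=
    abs_sub_mul_le_cube_of_odd (φ := fun t => partialFst F (0, t))
      (φ₁ := fun t => partialSnd (partialFst F) (0, t)) (fun t => c₁.hasDerivAt_partialSnd 0 t)
      (fun t => c₂.hasDerivAt_partialSnd 0 t) (fun t => c₂₂.hasDerivAt_partialSnd 0 t)
      odd₁ hN.le (a := 1) (fun t t0 t1 => bN 0 t le_rfl zero_le_one t0 t1) k k0 k1
  calc |F (h, k) - h * k * partialSnd (partialFst F) (0, 0)|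
      = |(F (h, k) - h * partialFst F (0, k)) +
          h * (partialFst F (0, k) - k * partialSnd (partialFst F) (0, 0))| := by ring_nf
    _ ≤ |F (h, k) - h * partialFst F (0, k)| +
          h * |partialFst F (0, k) - k * partialSnd (partialFst F) (0, 0)| := by
        refine (abs_add_le _ _).trans_eq ?_
        rw [abs_mul, abs_of_nonneg h0]
    _ ≤ M * k * h ^ 3 + h * (N * k ^ 3) := by gcongr
    _ ≤ (M + N) * (h * k * (h ^ 2 + k ^ 2)) := by
        have p₁ : 0 ≤ M * (h * k ^ 3) := by positivity
        have p₂ : 0 ≤ N * (h ^ 3 * k) := by positivity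
        linarith

/-- The sum of the three Arakawa stencils, without the factor `1 / (4 * p.1 * p.2)`. -/
noncomputable def arakawaNumerator (f g : ℝ × ℝ → ℝ) (x y : ℝ) (p : ℝ × ℝ) : ℝ :=
  ((f (x + p.1, y) - f (x - p.1, y)) * (g (x, y + p.2) - g (x, y - p.2)) -
      (f (x, y + p.2) - f (x, y - p.2)) * (g (x + p.1, y) - g (x - p.1, y))) +
    (f (x + p.1, y) * (g (x + p.1, y + p.2) - g (x + p.1, y - p.2)) -
      f (x - p.1, y) * (g (x - p.1, y + p.2) - g (x - p.1, y - p.2)) -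
      f (x, y + p.2) * (g (x + p.1, y + p.2) - g (x - p.1, y + p.2)) +
      f (x, y - p.2) * (g (x + p.1, y - p.2) - g (x - p.1, y - p.2))) +
    (f (x + p.1, y + p.2) * (g (x, y + p.2) - g (x + p.1, y)) -
      f (x - p.1, y - p.2) * (g (x - p.1, y) - g (x, y - p.2)) -
      f (x - p.1, y + p.2) * (g (x, y + p.2) - g (x - p.1, y)) +
      f (x + p.1, y - p.2) * (g (x + p.1, y) - g (x, y - p.2)))

theorem ContDiff.arakawaNumerator {f g : ℝ × ℝ → ℝ} (hf : ContDiff ℝ (⊤ : ℕ∞) f)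
    (hg : ContDiff ℝ (⊤ : ℕ∞) g) (x y : ℝ) :
    ContDiff ℝ (⊤ : ℕ∞) (arakawaNumerator f g x y) := by
  unfold _root_.arakawaNumerator
  fun_prop

theorem partialFst_arakawaNumerator {f g : ℝ × ℝ → ℝ} (hf : ContDiff ℝ (⊤ : ℕ∞) f)
    (hg : ContDiff ℝ (⊤ : ℕ∞) g) (x y k : ℝ) :
    partialFst (arakawaNumerator f g x y) (0, k) =
      4 * partialFst f (x, y) * (g (x, y + k) - g (x, y - k)) -
        4 * (f (x, y + k) - f (x, y - k)) * partialFst g (x, y) +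
      2 * f (x, y) * (partialFst g (x, y + k) - partialFst g (x, y - k)) -
        2 * f (x, y + k) * partialFst g (x, y + k) +
        2 * f (x, y - k) * partialFst g (x, y - k) +
      2 * partialFst f (x, y + k) * (g (x, y + k) - g (x, y)) +
        2 * partialFst f (x, y - k) * (g (x, y) - g (x, y - k)) := by
  have plus : ∀ {u : ℝ × ℝ → ℝ}, ContDiff ℝ (⊤ : ℕ∞) u → ∀ b,
      HasDerivAt (fun t => u (x + t, b)) (partialFst u (x, b)) 0 := fun hu b => by
    simpa using (show HasDerivAt _ _ (x + 0) from
      hu.hasDerivAt_partialFst (x + 0) b).comp_const_add x 0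
  have minus : ∀ {u : ℝ × ℝ → ℝ}, ContDiff ℝ (⊤ : ℕ∞) u → ∀ b,
      HasDerivAt (fun t => u (x - t, b)) (-partialFst u (x, b)) 0 := fun hu b => by
    simpa using (show HasDerivAt _ _ (x - 0) from
      hu.hasDerivAt_partialFst (x - 0) b).comp_const_sub x 0
  have cst : ∀ c : ℝ, HasDerivAt (fun _ : ℝ => c) 0 0 := fun c => hasDerivAt_const 0 c
  refine ((hf.arakawaNumerator hg x y).hasDerivAt_partialFst 0 k).unique ?_
  have key :=
    (((((plus hf y).fun_sub (minus hf y)).fun_mul (cst (g (x, y + k) - g (x, y - k)))).fun_sub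
      ((cst (f (x, y + k) - f (x, y - k))).fun_mul ((plus hg y).fun_sub (minus hg y)))).fun_add
    (((((plus hf y).fun_mul ((plus hg (y + k)).fun_sub (plus hg (y - k)))).fun_sub
      ((minus hf y).fun_mul ((minus hg (y + k)).fun_sub (minus hg (y - k))))).fun_sub
      ((cst (f (x, y + k))).fun_mul ((plus hg (y + k)).fun_sub (minus hg (y + k))))).fun_add
      ((cst (f (x, y - k))).fun_mul ((plus hg (y - k)).fun_sub (minus hg (y - k)))))).fun_add
    (((((plus hf (y + k)).fun_mul ((cst (g (x, y + k))).fun_sub (plus hg y))).fun_sub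
      ((minus hf (y - k)).fun_mul ((minus hg y).fun_sub (cst (g (x, y - k)))))).fun_sub
      ((minus hf (y + k)).fun_mul ((cst (g (x, y + k))).fun_sub (minus hg y)))).fun_add
      ((plus hf (y - k)).fun_mul ((plus hg y).fun_sub (cst (g (x, y - k))))))
  refine key.congr_deriv ?_
  simp only [add_zero, sub_zero]
  ring

theorem partialSnd_partialFst_arakawaNumerator {f g : ℝ × ℝ → ℝ} (hf : ContDiff ℝ (⊤ : ℕ∞) f)
    (hg : ContDiff ℝ (⊤ : ℕ∞) g) (x y : ℝ) :
    partialSnd (partialFst (arakawaNumerator f g x y)) (0, 0) =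
      12 * (partialFst f (x, y) * partialSnd g (x, y) -
        partialSnd f (x, y) * partialFst g (x, y)) := by
  have plus : ∀ {u : ℝ × ℝ → ℝ}, ContDiff ℝ (⊤ : ℕ∞) u →
      HasDerivAt (fun t => u (x, y + t)) (partialSnd u (x, y)) 0 := fun hu => by
    simpa using (show HasDerivAt _ _ (y + 0) from
      hu.hasDerivAt_partialSnd x (y + 0)).comp_const_add y 0
  have minus : ∀ {u : ℝ × ℝ → ℝ}, ContDiff ℝ (⊤ : ℕ∞) u →
      HasDerivAt (fun t => u (x, y - t)) (-partialSnd u (x, y)) 0 := fun hu => by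
    simpa using (show HasDerivAt _ _ (y - 0) from
      hu.hasDerivAt_partialSnd x (y - 0)).comp_const_sub y 0
  have hd := (hf.arakawaNumerator hg x y).partialFst.hasDerivAt_partialSnd 0 0
  simp only [partialFst_arakawaNumerator hf hg] at hd
  refine hd.unique ?_
  have key :=
    ((((((((plus hg).fun_sub (minus hg)).const_mul (4 * partialFst f (x, y))).fun_sub
      ((((plus hf).fun_sub (minus hf)).const_mul 4).mul_const (partialFst g (x, y)))).fun_add
      (((plus hg.partialFst).fun_sub (minus hg.partialFst)).const_mul (2 * f (x, y)))).fun_sub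
      (((plus hf).const_mul 2).fun_mul (plus hg.partialFst))).fun_add
      (((minus hf).const_mul 2).fun_mul (minus hg.partialFst))).fun_add
      (((plus hf.partialFst).const_mul 2).fun_mul ((plus hg).sub_const (g (x, y))))).fun_add
      (((minus hf.partialFst).const_mul 2).fun_mul ((minus hg).const_sub (g (x, y))))
  refine key.congr_deriv ?_
  simp only [add_zero, sub_zero]
  ring

theorem J1_eq_arakawaNumerator_div (dx dy : ℝ) (f g : ℝ × ℝ → ℝ) (x y : ℝ) :
    J1 dx dy f g x y = arakawaNumerator f g x y (dx, dy) / (12 * (dx * dy)) := by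
  simp only [J1, J1pp, J1px, J1xp, arakawaNumerator, div_eq_mul_inv, mul_inv]
  ring

/-- The anisotropic second-order Arakawa approximation `J1` of the Poisson bracket is
second-order accurate. -/
theorem J1_second_order_accurate (f g : ℝ × ℝ → ℝ)
    (hf : ContDiff ℝ (⊤ : ℕ∞) f) (hg : ContDiff ℝ (⊤ : ℕ∞) g) (x y : ℝ) :
    ∃ C > (0 : ℝ), ∃ ε > (0 : ℝ), ∀ dx dy : ℝ,
      0 < dx → dx ≤ ε → 0 < dy → dy ≤ ε →
      |J1 dx dy f g x y -
          (fderiv ℝ f (x, y) (1, 0) * fderiv ℝ g (x, y) (0, 1) -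
            fderiv ℝ f (x, y) (0, 1) * fderiv ℝ g (x, y) (1, 0))| ≤
        C * (dx ^ 2 + dy ^ 2) := by
  obtain ⟨C, hC, bound⟩ := exists_bound_of_odd_odd (hf.arakawaNumerator hg x y)
    (fun h k => by simp only [arakawaNumerator, sub_neg_eq_add, ← sub_eq_add_neg]; ring)
    (fun h k => by simp only [arakawaNumerator, sub_neg_eq_add, ← sub_eq_add_neg]; ring)
  refine ⟨C, hC, 1, one_pos, fun dx dy hx hx1 hy hy1 => ?_⟩
  have b := bound dx dy hx.le hx1 hy.le hy1
  rw [partialSnd_partialFst_arakawaNumerator hf hg] at b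
  change |J1 dx dy f g x y - (partialFst f (x, y) * partialSnd g (x, y) -
    partialSnd f (x, y) * partialFst g (x, y))| ≤ _
  generalize partialFst f (x, y) * partialSnd g (x, y) -
    partialSnd f (x, y) * partialFst g (x, y) = c at b ⊢
  have hxy : 0 < dx * dy := mul_pos hx hy
  have e : J1 dx dy f g x y - c =
      (arakawaNumerator f g x y (dx, dy) - dx * dy * (12 * c)) / (12 * (dx * dy)) := by
    rw [J1_eq_arakawaNumerator_div]
    field_simp
  rw [e, abs_div, abs_of_pos (by positivity : 0 < 12 * (dx * dy)), div_le_iff₀ (by positivity)]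
  have p : 0 ≤ C * (dx * dy * (dx ^ 2 + dy ^ 2)) := by positivity
  linarith
end

section
/- The anisotropic fourth-order Arakawa approximation Jh = 2·J1 − J2 of the Poisson bracket is fourth-order accurate: for infinitely differentiable functions f, g : ℝ × ℝ → ℝ and a point (x,y) ∈ ℝ², there exist constants C > 0 and ε > 0 such that for all spacings Δx, Δy with 0 < Δx ≤ ε and 0 < Δy ≤ ε, |2·J1_{Δx,Δy}(f,g)(x,y) − J2_{Δx,Δy}(f,g)(x,y) − (∂f/∂x·∂g/∂y − ∂f/∂y·∂g/∂x)(x,y)| ≤ C·(Δx² + Δy²)². -/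
noncomputable def J2xx (dx dy : ℝ) (f g : ℝ × ℝ → ℝ) (x y : ℝ) : ℝ :=
  (1 / (8 * dx * dy)) *
    ((f (x + dx, y + dy) - f (x - dx, y - dy)) * (g (x - dx, y + dy) - g (x + dx, y - dy)) -
      (f (x - dx, y + dy) - f (x + dx, y - dy)) * (g (x + dx, y + dy) - g (x - dx, y - dy)))

noncomputable def J2xp (dx dy : ℝ) (f g : ℝ × ℝ → ℝ) (x y : ℝ) : ℝ :=
  (1 / (8 * dx * dy)) *
    (f (x + dx, y + dy) * (g (x, y + 2 * dy) - g (x + 2 * dx, y)) -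
      f (x - dx, y - dy) * (g (x - 2 * dx, y) - g (x, y - 2 * dy)) -
      f (x - dx, y + dy) * (g (x, y + 2 * dy) - g (x - 2 * dx, y)) +
      f (x + dx, y - dy) * (g (x + 2 * dx, y) - g (x, y - 2 * dy)))

noncomputable def J2px (dx dy : ℝ) (f g : ℝ × ℝ → ℝ) (x y : ℝ) : ℝ :=
  (1 / (8 * dx * dy)) *
    (f (x + 2 * dx, y) * (g (x + dx, y + dy) - g (x + dx, y - dy)) -
      f (x - 2 * dx, y) * (g (x - dx, y + dy) - g (x - dx, y - dy)) -
      f (x, y + 2 * dy) * (g (x + dx, y + dy) - g (x - dx, y + dy)) +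
      f (x, y - 2 * dy) * (g (x + dx, y - dy) - g (x - dx, y - dy)))

noncomputable def J2 (dx dy : ℝ) (f g : ℝ × ℝ → ℝ) (x y : ℝ) : ℝ :=
  (1 / 3) * (J2xx dx dy f g x y + J2xp dx dy f g x y + J2px dx dy f g x y)

open scoped ContDiff

/-- The directional derivative of `h` along the constant vector field `v`. -/
noncomputable def dirDeriv (v : ℝ × ℝ) (h : ℝ × ℝ → ℝ) : ℝ × ℝ → ℝ :=
  fun p => fderiv ℝ h p v

/-- The map `(s, t) ↦ (z.1 + a s, z.2 + b t)`. -/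
def axisAffine (z : ℝ × ℝ) (a b : ℝ) (p : ℝ × ℝ) : ℝ × ℝ := (z.1 + a * p.1, z.2 + b * p.2)

theorem ContDiff.dirDeriv {h : ℝ × ℝ → ℝ} (hh : ContDiff ℝ ∞ h) (v : ℝ × ℝ) :
    ContDiff ℝ ∞ (dirDeriv v h) :=
  (hh.fderiv_right (m := ∞) (by simp)).clm_apply contDiff_const

theorem dirDeriv_zero (v : ℝ × ℝ) : dirDeriv v 0 = 0 := by
  funext p
  simp [dirDeriv]

theorem dirDeriv_add {h k : ℝ × ℝ → ℝ} (hh : ContDiff ℝ ∞ h) (hk : ContDiff ℝ ∞ k)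
    (v : ℝ × ℝ) : dirDeriv v (h + k) = dirDeriv v h + dirDeriv v k := by
  funext p
  simp only [dirDeriv, Pi.add_apply]
  rw [fderiv_add (hh.differentiable (by simp) p) (hk.differentiable (by simp) p)]
  simp

theorem contDiff_pi_add {h k : ℝ × ℝ → ℝ} (hh : ContDiff ℝ ∞ h) (hk : ContDiff ℝ ∞ k) :
    ContDiff ℝ ∞ (h + k) :=
  hh.add hk

theorem dirDeriv_smul {h : ℝ × ℝ → ℝ} (hh : ContDiff ℝ ∞ h) (c : ℝ) (v : ℝ × ℝ) :
    dirDeriv v (c • h) = c • dirDeriv v h := by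
  funext p
  simp only [dirDeriv, Pi.smul_apply]
  rw [fderiv_const_smul (hh.differentiable (by simp) p)]
  simp

theorem dirDeriv_mul {h k : ℝ × ℝ → ℝ} (hh : ContDiff ℝ ∞ h) (hk : ContDiff ℝ ∞ k)
    (v : ℝ × ℝ) : dirDeriv v (h * k) = dirDeriv v h * k + h * dirDeriv v k := by
  funext p
  simp only [dirDeriv, Pi.add_apply, Pi.mul_apply]
  rw [fderiv_mul (hh.differentiable (by simp) p) (hk.differentiable (by simp) p)]
  simp
  ring

theorem contDiff_axisAffine (z : ℝ × ℝ) (a b : ℝ) : ContDiff ℝ ∞ (axisAffine z a b) := by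
  unfold axisAffine
  fun_prop

theorem dirDeriv_comp_axisAffine {h : ℝ × ℝ → ℝ} (hh : ContDiff ℝ ∞ h) (z v : ℝ × ℝ)
    (a b : ℝ) (p : ℝ × ℝ) :
    dirDeriv v (h ∘ axisAffine z a b) p =
      fderiv ℝ h (axisAffine z a b p) (a * v.1, b * v.2) := by
  have hA : HasFDerivAt (axisAffine z a b)
      ((a • ContinuousLinearMap.fst ℝ ℝ ℝ).prod (b • ContinuousLinearMap.snd ℝ ℝ ℝ)) p :=
    ((hasFDerivAt_fst.const_mul a).const_add z.1).prodMk
      ((hasFDerivAt_snd.const_mul b).const_add z.2)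
  have h1 := (hh.differentiable (by simp) (axisAffine z a b p)).hasFDerivAt.comp p hA
  simp [dirDeriv, h1.fderiv]

theorem dirDeriv_fst_comp_axisAffine {h : ℝ × ℝ → ℝ} (hh : ContDiff ℝ ∞ h) (z : ℝ × ℝ)
    (a b : ℝ) :
    dirDeriv (1, 0) (h ∘ axisAffine z a b) = a • (dirDeriv (1, 0) h ∘ axisAffine z a b) := by
  funext p
  have hv : ((a * 1, b * 0) : ℝ × ℝ) = a • (1, 0) := by simp
  rw [dirDeriv_comp_axisAffine hh, hv, map_smul]
  rfl

theorem dirDeriv_snd_comp_axisAffine {h : ℝ × ℝ → ℝ} (hh : ContDiff ℝ ∞ h) (z : ℝ × ℝ)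
    (a b : ℝ) :
    dirDeriv (0, 1) (h ∘ axisAffine z a b) = b • (dirDeriv (0, 1) h ∘ axisAffine z a b) := by
  funext p
  have hv : ((a * 0, b * 1) : ℝ × ℝ) = b • (0, 1) := by simp
  rw [dirDeriv_comp_axisAffine hh, hv, map_smul]
  rfl

/-! ### Parity under the coordinate reflections -/

theorem dirDeriv_fst_parity {h : ℝ × ℝ → ℝ} (hh : ContDiff ℝ ∞ h) {a b c : ℝ}
    (hp : h ∘ axisAffine 0 a b = c • h) (ha : a * a = 1) :
    dirDeriv (1, 0) h ∘ axisAffine 0 a b = (a * c) • dirDeriv (1, 0) h := by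
  have h1 := dirDeriv_fst_comp_axisAffine hh 0 a b
  rw [hp, dirDeriv_smul hh] at h1
  rw [mul_smul, h1, smul_smul, ha, one_smul]

theorem dirDeriv_snd_parity {h : ℝ × ℝ → ℝ} (hh : ContDiff ℝ ∞ h) {a b c : ℝ}
    (hp : h ∘ axisAffine 0 a b = c • h) (hb : b * b = 1) :
    dirDeriv (0, 1) h ∘ axisAffine 0 a b = (b * c) • dirDeriv (0, 1) h := by
  have h1 := dirDeriv_snd_comp_axisAffine hh 0 a b
  rw [hp, dirDeriv_smul hh] at h1
  rw [mul_smul, h1, smul_smul, hb, one_smul]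

theorem eq_zero_of_odd_fst {h : ℝ × ℝ → ℝ} {c : ℝ}
    (hp : h ∘ axisAffine 0 (-1) 1 = c • h) (hc : c = -1) (t : ℝ) : h (0, t) = 0 := by
  have := congrFun hp (0, t)
  simp [axisAffine, hc] at this
  linarith

theorem eq_zero_of_odd_snd {h : ℝ × ℝ → ℝ} {c : ℝ}
    (hp : h ∘ axisAffine 0 1 (-1) = c • h) (hc : c = -1) (s : ℝ) : h (s, 0) = 0 := by
  have := congrFun hp (s, 0)
  simp [axisAffine, hc] at this
  linarith

/-! ### Mean value inequalities -/

theorem abs_sub_le_of_dirDeriv_fst {h : ℝ × ℝ → ℝ} (hh : ContDiff ℝ ∞ h) {s t m B : ℝ}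
    (hs : 0 ≤ s) (hB : ∀ u ∈ Set.Icc 0 s, |dirDeriv (1, 0) h (u, t) - m| ≤ B) :
    |h (s, t) - h (0, t) - m * s| ≤ B * s := by
  have hd : ∀ u : ℝ, HasDerivAt (fun u => h (u, t) - m * u)
      (dirDeriv (1, 0) h (u, t) - m) u := by
    intro u
    have h1 := (hh.differentiable (by simp) (u, t)).hasFDerivAt.comp_hasDerivAt u
      ((hasDerivAt_id u).prodMk (hasDerivAt_const u t))
    have h2 := h1.sub ((hasDerivAt_id u).const_mul m)
    rw [mul_one] at h2
    exact h2
  have := norm_image_sub_le_of_norm_deriv_le_segment'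
    (fun u _ => (hd u).hasDerivWithinAt)
    (fun u hu => hB u ⟨hu.1, hu.2.le⟩) s ⟨hs, le_rfl⟩
  rw [Real.norm_eq_abs] at this
  calc _ = |h (s, t) - m * s - (h (0, t) - m * 0)| := by ring_nf
    _ ≤ B * (s - 0) := this
    _ = B * s := by ring

theorem abs_sub_le_of_dirDeriv_snd {h : ℝ × ℝ → ℝ} (hh : ContDiff ℝ ∞ h) {s t m B : ℝ}
    (ht : 0 ≤ t) (hB : ∀ u ∈ Set.Icc 0 t, |dirDeriv (0, 1) h (s, u) - m| ≤ B) :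
    |h (s, t) - h (s, 0) - m * t| ≤ B * t := by
  have hd : ∀ u : ℝ, HasDerivAt (fun u => h (s, u) - m * u)
      (dirDeriv (0, 1) h (s, u) - m) u := by
    intro u
    have h1 := (hh.differentiable (by simp) (s, u)).hasFDerivAt.comp_hasDerivAt u
      ((hasDerivAt_const u s).prodMk (hasDerivAt_id u))
    have h2 := h1.sub ((hasDerivAt_id u).const_mul m)
    rw [mul_one] at h2
    exact h2
  have := norm_image_sub_le_of_norm_deriv_le_segment'
    (fun u _ => (hd u).hasDerivWithinAt)
    (fun u hu => hB u ⟨hu.1, hu.2.le⟩) t ⟨ht, le_rfl⟩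
  rw [Real.norm_eq_abs] at this
  calc _ = |h (s, t) - m * t - (h (s, 0) - m * 0)| := by ring_nf
    _ ≤ B * (t - 0) := this
    _ = B * t := by ring

theorem abs_le_of_dirDeriv_fst {h : ℝ × ℝ → ℝ} (hh : ContDiff ℝ ∞ h) {s t B : ℝ}
    (hs : 0 ≤ s) (h0 : h (0, t) = 0)
    (hB : ∀ u ∈ Set.Icc 0 s, |dirDeriv (1, 0) h (u, t)| ≤ B) : |h (s, t)| ≤ B * s := by
  have := abs_sub_le_of_dirDeriv_fst hh (m := 0) hs (by simpa only [sub_zero] using hB)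
  rwa [h0, zero_mul, sub_zero, sub_zero] at this

theorem abs_le_of_dirDeriv_snd {h : ℝ × ℝ → ℝ} (hh : ContDiff ℝ ∞ h) {s t B : ℝ}
    (ht : 0 ≤ t) (h0 : h (s, 0) = 0)
    (hB : ∀ u ∈ Set.Icc 0 t, |dirDeriv (0, 1) h (s, u)| ≤ B) : |h (s, t)| ≤ B * t := by
  have := abs_sub_le_of_dirDeriv_snd hh (m := 0) ht (by simpa only [sub_zero] using hB)
  rwa [h0, zero_mul, sub_zero, sub_zero] at this

theorem exists_bound_on_unit_square_s9 {h : ℝ × ℝ → ℝ} (hh : ContDiff ℝ ∞ h) :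
    ∃ K : ℝ, 0 ≤ K ∧ ∀ s ∈ Set.Icc (0 : ℝ) 1, ∀ t ∈ Set.Icc (0 : ℝ) 1, |h (s, t)| ≤ K := by
  obtain ⟨K, hK⟩ := (isCompact_Icc.prod isCompact_Icc :
    IsCompact (Set.Icc (0 : ℝ) 1 ×ˢ Set.Icc (0 : ℝ) 1)).exists_bound_of_continuousOn
      hh.continuous.continuousOn
  exact ⟨max K 0, le_max_right _ _,
    fun s hs t ht => (hK (s, t) ⟨hs, ht⟩).trans (le_max_left _ _)⟩

/-- A smooth function that is even in each variable and whose two pure second derivatives vanish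
at the origin is constant up to fourth order there. -/
theorem exists_fourth_order_bound_of_even {M : ℝ × ℝ → ℝ} (hM : ContDiff ℝ ∞ M)
    (hs : M ∘ axisAffine 0 (-1) 1 = (1 : ℝ) • M) (ht : M ∘ axisAffine 0 1 (-1) = (1 : ℝ) • M)
    (h11 : dirDeriv (1, 0) (dirDeriv (1, 0) M) (0, 0) = 0)
    (h22 : dirDeriv (0, 1) (dirDeriv (0, 1) M) (0, 0) = 0) :
    ∃ K : ℝ, 0 ≤ K ∧ ∀ s ∈ Set.Icc (0 : ℝ) 1, ∀ t ∈ Set.Icc (0 : ℝ) 1,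
      |M (s, t) - M (0, 0)| ≤ K * (s ^ 2 + t ^ 2) ^ 2 := by
  have c1 := hM.dirDeriv (1, 0)
  have c11 := c1.dirDeriv (1, 0)
  have c111 := c11.dirDeriv (1, 0)
  have c112 := c11.dirDeriv (0, 1)
  have c2 := hM.dirDeriv (0, 1)
  have c22 := c2.dirDeriv (0, 1)
  have c222 := c22.dirDeriv (0, 1)
  have p1 := dirDeriv_fst_parity hM hs (by norm_num)
  have p11 := dirDeriv_fst_parity c1 p1 (by norm_num)
  have p111 := dirDeriv_fst_parity c11 p11 (by norm_num)
  have q1 := dirDeriv_fst_parity hM ht (by norm_num)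
  have q11 := dirDeriv_fst_parity c1 q1 (by norm_num)
  have q112 := dirDeriv_snd_parity c11 q11 (by norm_num)
  have q2 := dirDeriv_snd_parity hM ht (by norm_num)
  have q22 := dirDeriv_snd_parity c2 q2 (by norm_num)
  have q222 := dirDeriv_snd_parity c22 q22 (by norm_num)
  obtain ⟨K₁, hK₁, b₁⟩ := exists_bound_on_unit_square_s9 (c111.dirDeriv (1, 0))
  obtain ⟨K₂, hK₂, b₂⟩ := exists_bound_on_unit_square_s9 (c112.dirDeriv (0, 1))
  obtain ⟨K₃, hK₃, b₃⟩ := exists_bound_on_unit_square_s9 (c222.dirDeriv (0, 1))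
  have hmem : ∀ {u v : ℝ}, u ∈ Set.Icc 0 v → v ∈ Set.Icc (0 : ℝ) 1 → u ∈ Set.Icc (0 : ℝ) 1 :=
    fun hu hv => ⟨hu.1, hu.2.trans hv.2⟩
  have e0 : (0 : ℝ) ∈ Set.Icc (0 : ℝ) 1 := by simp
  have e222 : ∀ t ∈ Set.Icc (0 : ℝ) 1,
      |dirDeriv (0, 1) (dirDeriv (0, 1) (dirDeriv (0, 1) M)) (0, t)| ≤ K₃ * t :=
    fun t ht => abs_le_of_dirDeriv_snd c222 ht.1 (eq_zero_of_odd_snd q222 (by norm_num) 0)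
      fun u hu => b₃ 0 e0 u (hmem hu ht)
  have e22 : ∀ t ∈ Set.Icc (0 : ℝ) 1,
      |dirDeriv (0, 1) (dirDeriv (0, 1) M) (0, t)| ≤ K₃ * t * t :=
    fun t ht => abs_le_of_dirDeriv_snd c22 ht.1 h22
      fun u hu => (e222 u (hmem hu ht)).trans (by
        have := hu.1; have := hu.2; have := ht.1; gcongr)
  have e2 : ∀ t ∈ Set.Icc (0 : ℝ) 1, |dirDeriv (0, 1) M (0, t)| ≤ K₃ * t * t * t :=
    fun t ht => abs_le_of_dirDeriv_snd c2 ht.1 (eq_zero_of_odd_snd q2 (by norm_num) 0)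
      fun u hu => (e22 u (hmem hu ht)).trans (by
        have := hu.1; have := hu.2; have := ht.1; gcongr)
  have e : ∀ t ∈ Set.Icc (0 : ℝ) 1, |M (0, t) - M (0, 0) - 0 * t| ≤ K₃ * t * t * t * t :=
    fun t ht => abs_sub_le_of_dirDeriv_snd hM ht.1 fun u hu => by
      rw [sub_zero]
      exact (e2 u (hmem hu ht)).trans (by
        have := hu.1; have := hu.2; have := ht.1; gcongr)
  have e112 : ∀ t ∈ Set.Icc (0 : ℝ) 1,
      |dirDeriv (0, 1) (dirDeriv (1, 0) (dirDeriv (1, 0) M)) (0, t)| ≤ K₂ * t :=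
    fun t ht => abs_le_of_dirDeriv_snd c112 ht.1 (eq_zero_of_odd_snd q112 (by norm_num) 0)
      fun u hu => b₂ 0 e0 u (hmem hu ht)
  have e11 : ∀ t ∈ Set.Icc (0 : ℝ) 1,
      |dirDeriv (1, 0) (dirDeriv (1, 0) M) (0, t)| ≤ K₂ * t * t :=
    fun t ht => abs_le_of_dirDeriv_snd c11 ht.1 h11
      fun u hu => (e112 u (hmem hu ht)).trans (by
        have := hu.1; have := hu.2; have := ht.1; gcongr)
  have d111 : ∀ s ∈ Set.Icc (0 : ℝ) 1, ∀ t ∈ Set.Icc (0 : ℝ) 1,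
      |dirDeriv (1, 0) (dirDeriv (1, 0) (dirDeriv (1, 0) M)) (s, t)| ≤ K₁ * s :=
    fun s hs t ht => abs_le_of_dirDeriv_fst c111 hs.1 (eq_zero_of_odd_fst p111 (by norm_num) t)
      fun u hu => b₁ u (hmem hu hs) t ht
  have d11 : ∀ s ∈ Set.Icc (0 : ℝ) 1, ∀ t ∈ Set.Icc (0 : ℝ) 1,
      |dirDeriv (1, 0) (dirDeriv (1, 0) M) (s, t)| ≤ K₁ * s * s + K₂ * t * t := by
    intro s hs t ht
    have h := abs_sub_le_of_dirDeriv_fst c11 (t := t) (m := 0) (B := K₁ * s) hs.1 fun u hu => by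
      rw [sub_zero]
      exact (d111 u (hmem hu hs) t ht).trans (by
        have := hu.1; have := hu.2; have := hs.1; gcongr)
    have h' := e11 t ht
    rw [abs_le] at h h' ⊢
    constructor <;> linarith [h.1, h.2, h'.1, h'.2]
  have d1 : ∀ s ∈ Set.Icc (0 : ℝ) 1, ∀ t ∈ Set.Icc (0 : ℝ) 1,
      |dirDeriv (1, 0) M (s, t)| ≤ (K₁ * s * s + K₂ * t * t) * s :=
    fun s hs t ht => abs_le_of_dirDeriv_fst c1 hs.1 (eq_zero_of_odd_fst p1 (by norm_num) t)
      fun u hu => (d11 u (hmem hu hs) t ht).trans (by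
        have := hu.1; have := hu.2; have := hs.1; gcongr)
  have d : ∀ s ∈ Set.Icc (0 : ℝ) 1, ∀ t ∈ Set.Icc (0 : ℝ) 1,
      |M (s, t) - M (0, t) - 0 * s| ≤ (K₁ * s * s + K₂ * t * t) * s * s :=
    fun s hs t ht => abs_sub_le_of_dirDeriv_fst hM hs.1 fun u hu => by
      rw [sub_zero]
      refine (d1 u (hmem hu hs) t ht).trans ?_
      have := hu.1
      have := hu.2
      have := hs.1
      have := mul_nonneg (mul_nonneg hK₂ ht.1) ht.1
      gcongr
  refine ⟨K₁ + K₂ + K₃, by positivity, fun s hs t ht => ?_⟩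
  have hd := d s hs t ht
  have he := e t ht
  have hle : (K₁ * s * s + K₂ * t * t) * s * s + K₃ * t * t * t * t ≤
      (K₁ + K₂ + K₃) * (s ^ 2 + t ^ 2) ^ 2 := by
    rw [← sub_nonneg]
    calc (0 : ℝ) ≤ K₁ * (2 * s ^ 2 * t ^ 2 + t ^ 4) + K₂ * (s ^ 4 + s ^ 2 * t ^ 2 + t ^ 4) +
          K₃ * (s ^ 4 + 2 * s ^ 2 * t ^ 2) := by positivity
      _ = _ := by ring
  rw [abs_le] at hd he ⊢
  constructor <;> linarith [hd.1, hd.2, he.1, he.2]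

/-- A smooth function that is odd in each variable and whose `s³t` and `st³` Taylor coefficients
vanish agrees with its `st` Taylor term up to a relative error of fourth order. -/
theorem exists_fourth_order_bound_of_odd {N : ℝ × ℝ → ℝ} (hN : ContDiff ℝ ∞ N)
    (hs : N ∘ axisAffine 0 (-1) 1 = (-1 : ℝ) • N)
    (ht : N ∘ axisAffine 0 1 (-1) = (-1 : ℝ) • N)
    (h31 : dirDeriv (1, 0) (dirDeriv (1, 0) (dirDeriv (0, 1) (dirDeriv (1, 0) N))) (0, 0) = 0)
    (h13 : dirDeriv (0, 1) (dirDeriv (0, 1) (dirDeriv (0, 1) (dirDeriv (1, 0) N))) (0, 0) = 0) :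
    ∃ K : ℝ, 0 ≤ K ∧ ∀ s ∈ Set.Icc (0 : ℝ) 1, ∀ t ∈ Set.Icc (0 : ℝ) 1,
      |N (s, t) - dirDeriv (0, 1) (dirDeriv (1, 0) N) (0, 0) * t * s| ≤
        K * (s ^ 2 + t ^ 2) ^ 2 * t * s := by
  have c1 := hN.dirDeriv (1, 0)
  have c12 := c1.dirDeriv (0, 1)
  have p1 := dirDeriv_fst_parity hN hs (by norm_num)
  have p12 := dirDeriv_snd_parity c1 p1 (by norm_num)
  have q1 := dirDeriv_fst_parity hN ht (by norm_num)
  have q12 := dirDeriv_snd_parity c1 q1 (by norm_num)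
  obtain ⟨K, hK, hb⟩ := exists_fourth_order_bound_of_even c12 (by rw [p12]; norm_num)
    (by rw [q12]; norm_num) h31 h13
  refine ⟨K, hK, fun s hs' t ht' => ?_⟩
  have hz := eq_zero_of_odd_fst hs rfl t
  have key := abs_sub_le_of_dirDeriv_fst hN (s := s) (t := t)
    (m := dirDeriv (0, 1) (dirDeriv (1, 0) N) (0, 0) * t)
    (B := K * (s ^ 2 + t ^ 2) ^ 2 * t) hs'.1 fun u hu => by
      have h := abs_sub_le_of_dirDeriv_snd c1 (s := u) (t := t)
        (m := dirDeriv (0, 1) (dirDeriv (1, 0) N) (0, 0))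
        (B := K * (s ^ 2 + t ^ 2) ^ 2) ht'.1 fun v hv => by
          refine (hb u ⟨hu.1, hu.2.trans hs'.2⟩ v ⟨hv.1, hv.2.trans ht'.2⟩).trans ?_
          have := hu.1
          have := hu.2
          have := hv.1
          have := hv.2
          gcongr
      rwa [eq_zero_of_odd_snd q1 (by norm_num) u, sub_zero] at h
  rwa [hz, sub_zero] at key

/-! ### Bilinear stencils -/

/-- The product of `f` and `g`, each sampled at a point displaced from `z` along the axes. -/
def shiftedProd (z : ℝ × ℝ) (a b c d : ℝ) (f g : ℝ × ℝ → ℝ) : ℝ × ℝ → ℝ :=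
  (f ∘ axisAffine z a b) * (g ∘ axisAffine z c d)

theorem contDiff_shiftedProd {f g : ℝ × ℝ → ℝ} (hf : ContDiff ℝ ∞ f) (hg : ContDiff ℝ ∞ g)
    (z : ℝ × ℝ) (a b c d : ℝ) : ContDiff ℝ ∞ (shiftedProd z a b c d f g) :=
  (hf.comp (contDiff_axisAffine z a b)).mul (hg.comp (contDiff_axisAffine z c d))

theorem dirDeriv_fst_shiftedProd {f g : ℝ × ℝ → ℝ} (hf : ContDiff ℝ ∞ f)
    (hg : ContDiff ℝ ∞ g) (z : ℝ × ℝ) (a b c d : ℝ) :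
    dirDeriv (1, 0) (shiftedProd z a b c d f g) =
      a • shiftedProd z a b c d (dirDeriv (1, 0) f) g +
        c • shiftedProd z a b c d f (dirDeriv (1, 0) g) := by
  unfold shiftedProd
  rw [dirDeriv_mul (hf.comp (contDiff_axisAffine z a b)) (hg.comp (contDiff_axisAffine z c d)),
    dirDeriv_fst_comp_axisAffine hf, dirDeriv_fst_comp_axisAffine hg, smul_mul_assoc,
    mul_smul_comm]

theorem dirDeriv_snd_shiftedProd {f g : ℝ × ℝ → ℝ} (hf : ContDiff ℝ ∞ f)
    (hg : ContDiff ℝ ∞ g) (z : ℝ × ℝ) (a b c d : ℝ) :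
    dirDeriv (0, 1) (shiftedProd z a b c d f g) =
      b • shiftedProd z a b c d (dirDeriv (0, 1) f) g +
        d • shiftedProd z a b c d f (dirDeriv (0, 1) g) := by
  unfold shiftedProd
  rw [dirDeriv_mul (hf.comp (contDiff_axisAffine z a b)) (hg.comp (contDiff_axisAffine z c d)),
    dirDeriv_snd_comp_axisAffine hf, dirDeriv_snd_comp_axisAffine hg, smul_mul_assoc,
    mul_smul_comm]

/-- The bilinear stencil with rows `(k, a, b, c, d)`, each contributing
`k f(z + (a s, b t)) g(z + (c s, d t))`. -/
def bilinStencil (z : ℝ × ℝ) (f g : ℝ × ℝ → ℝ) : List (ℝ × ℝ × ℝ × ℝ × ℝ) → ℝ × ℝ → ℝ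
  | [] => 0
  | (k, a, b, c, d) :: L => k • shiftedProd z a b c d f g + bilinStencil z f g L

theorem contDiff_bilinStencil {f g : ℝ × ℝ → ℝ} (hf : ContDiff ℝ ∞ f) (hg : ContDiff ℝ ∞ g)
    (z : ℝ × ℝ) (L : List (ℝ × ℝ × ℝ × ℝ × ℝ)) : ContDiff ℝ ∞ (bilinStencil z f g L) := by
  induction L with
  | nil => exact contDiff_const
  | cons q L ih => exact ((contDiff_shiftedProd hf hg z _ _ _ _).const_smul q.1).add ih

/-- The moment `∑ k aⁱ bʲ cᵐ dⁿ` of a list of stencil rows. -/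
def stencilMoment (i j m n : ℕ) (L : List (ℝ × ℝ × ℝ × ℝ × ℝ)) : ℝ :=
  (L.map fun q => q.1 * (q.2.1 ^ i * q.2.2.1 ^ j * q.2.2.2.1 ^ m * q.2.2.2.2 ^ n)).sum

/-- Multiply the weight of each stencil row by a function of the row. -/
def reweight (w : ℝ × ℝ × ℝ × ℝ → ℝ) (L : List (ℝ × ℝ × ℝ × ℝ × ℝ)) :
    List (ℝ × ℝ × ℝ × ℝ × ℝ) :=
  L.map fun q => (q.1 * w q.2, q.2)

theorem dirDeriv_fst_bilinStencil {f g : ℝ × ℝ → ℝ} (hf : ContDiff ℝ ∞ f)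
    (hg : ContDiff ℝ ∞ g) (z : ℝ × ℝ) (L : List (ℝ × ℝ × ℝ × ℝ × ℝ)) :
    dirDeriv (1, 0) (bilinStencil z f g L) =
      bilinStencil z (dirDeriv (1, 0) f) g (reweight (fun q => q.1) L) +
        bilinStencil z f (dirDeriv (1, 0) g) (reweight (fun q => q.2.2.1) L) := by
  induction L with
  | nil => simp [bilinStencil, reweight, dirDeriv_zero]
  | cons q L ih =>
    obtain ⟨k, a, b, c, d⟩ := q
    have hT := contDiff_shiftedProd hf hg z a b c d
    simp only [reweight, List.map_cons, bilinStencil] at ih ⊢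
    rw [dirDeriv_add (h := k • shiftedProd z a b c d f g) (hT.const_smul k)
      (contDiff_bilinStencil hf hg z L), dirDeriv_smul hT,
      dirDeriv_fst_shiftedProd hf hg, ih]
    module

theorem dirDeriv_snd_bilinStencil {f g : ℝ × ℝ → ℝ} (hf : ContDiff ℝ ∞ f)
    (hg : ContDiff ℝ ∞ g) (z : ℝ × ℝ) (L : List (ℝ × ℝ × ℝ × ℝ × ℝ)) :
    dirDeriv (0, 1) (bilinStencil z f g L) =
      bilinStencil z (dirDeriv (0, 1) f) g (reweight (fun q => q.2.1) L) +
        bilinStencil z f (dirDeriv (0, 1) g) (reweight (fun q => q.2.2.2) L) := by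
  induction L with
  | nil => simp [bilinStencil, reweight, dirDeriv_zero]
  | cons q L ih =>
    obtain ⟨k, a, b, c, d⟩ := q
    have hT := contDiff_shiftedProd hf hg z a b c d
    simp only [reweight, List.map_cons, bilinStencil] at ih ⊢
    rw [dirDeriv_add (h := k • shiftedProd z a b c d f g) (hT.const_smul k)
      (contDiff_bilinStencil hf hg z L), dirDeriv_smul hT,
      dirDeriv_snd_shiftedProd hf hg, ih]
    module

theorem bilinStencil_apply_zero (z : ℝ × ℝ) (f g : ℝ × ℝ → ℝ)
    (L : List (ℝ × ℝ × ℝ × ℝ × ℝ)) :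
    bilinStencil z f g L (0, 0) = stencilMoment 0 0 0 0 L * (f z * g z) := by
  induction L with
  | nil => simp [bilinStencil, stencilMoment]
  | cons q L ih =>
    simp only [stencilMoment, List.map_cons, List.sum_cons, bilinStencil, Pi.add_apply,
      Pi.smul_apply, smul_eq_mul] at ih ⊢
    rw [ih]
    simp [shiftedProd, axisAffine]
    ring

section Moments

variable (i j m n : ℕ) (L : List (ℝ × ℝ × ℝ × ℝ × ℝ))

theorem stencilMoment_reweight_fst :
    stencilMoment i j m n (reweight (fun q => q.1) L) = stencilMoment (i + 1) j m n L := by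
  simp only [stencilMoment, reweight, List.map_map, Function.comp_def]
  congr 2 with q
  ring

theorem stencilMoment_reweight_snd :
    stencilMoment i j m n (reweight (fun q => q.2.1) L) = stencilMoment i (j + 1) m n L := by
  simp only [stencilMoment, reweight, List.map_map, Function.comp_def]
  congr 2 with q
  ring

theorem stencilMoment_reweight_trd :
    stencilMoment i j m n (reweight (fun q => q.2.2.1) L) = stencilMoment i j (m + 1) n L := by
  simp only [stencilMoment, reweight, List.map_map, Function.comp_def]
  congr 2 with q
  ring

theorem stencilMoment_reweight_fth :
    stencilMoment i j m n (reweight (fun q => q.2.2.2) L) = stencilMoment i j m (n + 1) L := by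
  simp only [stencilMoment, reweight, List.map_map, Function.comp_def]
  congr 2 with q
  ring

end Moments

/-- The rows of the stencil of `24 Δx Δy (2 J1 - J2)`. -/
def arakawaRows : List (ℝ × ℝ × ℝ × ℝ × ℝ) :=
  [(4, 1, 0, 0, 1), (-4, 1, 0, 0, -1), (-4, -1, 0, 0, 1), (4, -1, 0, 0, -1),
   (-4, 0, 1, 1, 0), (4, 0, 1, -1, 0), (4, 0, -1, 1, 0), (-4, 0, -1, -1, 0),
   (4, 1, 0, 1, 1), (-4, 1, 0, 1, -1), (-4, -1, 0, -1, 1), (4, -1, 0, -1, -1),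
   (-4, 0, 1, 1, 1), (4, 0, 1, -1, 1), (4, 0, -1, 1, -1), (-4, 0, -1, -1, -1),
   (4, 1, 1, 0, 1), (-4, 1, 1, 1, 0), (-4, -1, -1, -1, 0), (4, -1, -1, 0, -1),
   (-4, -1, 1, 0, 1), (4, -1, 1, -1, 0), (4, 1, -1, 1, 0), (-4, 1, -1, 0, -1),
   (-1, 1, 1, -1, 1), (1, 1, 1, 1, -1), (1, -1, -1, -1, 1), (-1, -1, -1, 1, -1),
   (1, -1, 1, 1, 1), (-1, -1, 1, -1, -1), (-1, 1, -1, 1, 1), (1, 1, -1, -1, -1),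
   (-1, 1, 1, 0, 2), (1, 1, 1, 2, 0), (1, -1, -1, -2, 0), (-1, -1, -1, 0, -2),
   (1, -1, 1, 0, 2), (-1, -1, 1, -2, 0), (-1, 1, -1, 2, 0), (1, 1, -1, 0, -2),
   (-1, 2, 0, 1, 1), (1, 2, 0, 1, -1), (1, -2, 0, -1, 1), (-1, -2, 0, -1, -1),
   (1, 0, 2, 1, 1), (-1, 0, 2, -1, 1), (-1, 0, -2, 1, -1), (1, 0, -2, -1, -1)]

theorem bilinStencil_arakawaRows (f g : ℝ × ℝ → ℝ) (x y dx dy : ℝ) :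
    bilinStencil (x, y) f g arakawaRows (dx, dy) =
      4 * ((f (x + dx, y) - f (x - dx, y)) * (g (x, y + dy) - g (x, y - dy)) -
          (f (x, y + dy) - f (x, y - dy)) * (g (x + dx, y) - g (x - dx, y)) +
        (f (x + dx, y) * (g (x + dx, y + dy) - g (x + dx, y - dy)) -
          f (x - dx, y) * (g (x - dx, y + dy) - g (x - dx, y - dy)) -
          f (x, y + dy) * (g (x + dx, y + dy) - g (x - dx, y + dy)) +
          f (x, y - dy) * (g (x + dx, y - dy) - g (x - dx, y - dy))) +
        (f (x + dx, y + dy) * (g (x, y + dy) - g (x + dx, y)) -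
          f (x - dx, y - dy) * (g (x - dx, y) - g (x, y - dy)) -
          f (x - dx, y + dy) * (g (x, y + dy) - g (x - dx, y)) +
          f (x + dx, y - dy) * (g (x + dx, y) - g (x, y - dy)))) -
      ((f (x + dx, y + dy) - f (x - dx, y - dy)) * (g (x - dx, y + dy) - g (x + dx, y - dy)) -
          (f (x - dx, y + dy) - f (x + dx, y - dy)) *
            (g (x + dx, y + dy) - g (x - dx, y - dy)) +
        (f (x + dx, y + dy) * (g (x, y + 2 * dy) - g (x + 2 * dx, y)) -
          f (x - dx, y - dy) * (g (x - 2 * dx, y) - g (x, y - 2 * dy)) -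
          f (x - dx, y + dy) * (g (x, y + 2 * dy) - g (x - 2 * dx, y)) +
          f (x + dx, y - dy) * (g (x + 2 * dx, y) - g (x, y - 2 * dy))) +
        (f (x + 2 * dx, y) * (g (x + dx, y + dy) - g (x + dx, y - dy)) -
          f (x - 2 * dx, y) * (g (x - dx, y + dy) - g (x - dx, y - dy)) -
          f (x, y + 2 * dy) * (g (x + dx, y + dy) - g (x - dx, y + dy)) +
          f (x, y - 2 * dy) * (g (x + dx, y - dy) - g (x - dx, y - dy)))) := by
  simp only [arakawaRows, bilinStencil, shiftedProd, axisAffine, Pi.add_apply, Pi.smul_apply,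
    Pi.mul_apply, Function.comp_apply, smul_eq_mul, one_mul, neg_mul, zero_mul,
    add_zero, ← sub_eq_add_neg]
  ring

theorem bilinStencil_arakawaRows_eq (f g : ℝ × ℝ → ℝ) (x y : ℝ) {dx dy : ℝ} (hdx : dx ≠ 0)
    (hdy : dy ≠ 0) :
    2 * J1 dx dy f g x y - J2 dx dy f g x y =
      bilinStencil (x, y) f g arakawaRows (dx, dy) / (24 * dx * dy) := by
  rw [bilinStencil_arakawaRows]
  simp only [J1, J2, J1pp, J1px, J1xp, J2xx, J2xp, J2px]
  field_simp
  ring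

theorem bilinStencil_arakawaRows_odd_fst (f g : ℝ × ℝ → ℝ) (z : ℝ × ℝ) :
    bilinStencil z f g arakawaRows ∘ axisAffine 0 (-1) 1 =
      (-1 : ℝ) • bilinStencil z f g arakawaRows := by
  funext ⟨s, t⟩
  obtain ⟨x, y⟩ := z
  simp only [Function.comp_apply, axisAffine, Prod.fst_zero, Prod.snd_zero, zero_add, neg_mul,
    zero_sub, one_mul, Pi.smul_apply, smul_eq_mul, bilinStencil_arakawaRows, mul_neg,
    sub_neg_eq_add,
    ← sub_eq_add_neg]
  ring

theorem bilinStencil_arakawaRows_odd_snd (f g : ℝ × ℝ → ℝ) (z : ℝ × ℝ) :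
    bilinStencil z f g arakawaRows ∘ axisAffine 0 1 (-1) =
      (-1 : ℝ) • bilinStencil z f g arakawaRows := by
  funext ⟨s, t⟩
  obtain ⟨x, y⟩ := z
  simp only [Function.comp_apply, axisAffine, Prod.fst_zero, Prod.snd_zero, zero_add, neg_mul,
    zero_sub, one_mul, Pi.smul_apply, smul_eq_mul, bilinStencil_arakawaRows, mul_neg,
    sub_neg_eq_add,
    ← sub_eq_add_neg]
  ring

theorem dirDeriv_arakawaRows_one_one {f g : ℝ × ℝ → ℝ} (hf : ContDiff ℝ ∞ f)
    (hg : ContDiff ℝ ∞ g) (z : ℝ × ℝ) :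
    dirDeriv (0, 1) (dirDeriv (1, 0) (bilinStencil z f g arakawaRows)) (0, 0) =
      24 * (dirDeriv (1, 0) f z * dirDeriv (0, 1) g z -
        dirDeriv (0, 1) f z * dirDeriv (1, 0) g z) := by
  simp (maxDischargeDepth := 10) only [dirDeriv_fst_bilinStencil,
    dirDeriv_snd_bilinStencil, dirDeriv_add, hf, hg,
    ContDiff.dirDeriv, contDiff_bilinStencil, Pi.add_apply,
    bilinStencil_apply_zero,
    stencilMoment_reweight_fst, stencilMoment_reweight_snd, stencilMoment_reweight_trd,
    stencilMoment_reweight_fth]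
  norm_num [stencilMoment, arakawaRows]
  ring

theorem dirDeriv_arakawaRows_three_one {f g : ℝ × ℝ → ℝ} (hf : ContDiff ℝ ∞ f)
    (hg : ContDiff ℝ ∞ g) (z : ℝ × ℝ) :
    dirDeriv (1, 0) (dirDeriv (1, 0) (dirDeriv (0, 1) (dirDeriv (1, 0)
      (bilinStencil z f g arakawaRows)))) (0, 0) = 0 := by
  simp (maxDischargeDepth := 10) only [dirDeriv_fst_bilinStencil,
    dirDeriv_snd_bilinStencil, dirDeriv_add, hf, hg,
    ContDiff.dirDeriv, contDiff_pi_add, contDiff_bilinStencil, Pi.add_apply,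
    bilinStencil_apply_zero,
    stencilMoment_reweight_fst, stencilMoment_reweight_snd, stencilMoment_reweight_trd,
    stencilMoment_reweight_fth]
  norm_num [stencilMoment, arakawaRows]

theorem dirDeriv_arakawaRows_one_three {f g : ℝ × ℝ → ℝ} (hf : ContDiff ℝ ∞ f)
    (hg : ContDiff ℝ ∞ g) (z : ℝ × ℝ) :
    dirDeriv (0, 1) (dirDeriv (0, 1) (dirDeriv (0, 1) (dirDeriv (1, 0)
      (bilinStencil z f g arakawaRows)))) (0, 0) = 0 := by
  simp (maxDischargeDepth := 10) only [dirDeriv_fst_bilinStencil,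
    dirDeriv_snd_bilinStencil, dirDeriv_add, hf, hg,
    ContDiff.dirDeriv, contDiff_pi_add, contDiff_bilinStencil, Pi.add_apply,
    bilinStencil_apply_zero,
    stencilMoment_reweight_fst, stencilMoment_reweight_snd, stencilMoment_reweight_trd,
    stencilMoment_reweight_fth]
  norm_num [stencilMoment, arakawaRows]

/-- The anisotropic fourth-order Arakawa approximation `2·J1 − J2` of the Poisson bracket is
fourth-order accurate. -/
theorem Jh_fourth_order_accurate (f g : ℝ × ℝ → ℝ)
    (hf : ContDiff ℝ (⊤ : ℕ∞) f) (hg : ContDiff ℝ (⊤ : ℕ∞) g) (x y : ℝ) :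
    ∃ C > (0 : ℝ), ∃ ε > (0 : ℝ), ∀ dx dy : ℝ,
      0 < dx → dx ≤ ε → 0 < dy → dy ≤ ε →
      |2 * J1 dx dy f g x y - J2 dx dy f g x y -
          (fderiv ℝ f (x, y) (1, 0) * fderiv ℝ g (x, y) (0, 1) -
            fderiv ℝ f (x, y) (0, 1) * fderiv ℝ g (x, y) (1, 0))| ≤
        C * (dx ^ 2 + dy ^ 2) ^ 2 := by
  obtain ⟨K, hK, hb⟩ := exists_fourth_order_bound_of_odd
    (contDiff_bilinStencil hf hg (x, y) arakawaRows)
    (bilinStencil_arakawaRows_odd_fst f g (x, y)) (bilinStencil_arakawaRows_odd_snd f g (x, y))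
    (dirDeriv_arakawaRows_three_one hf hg (x, y)) (dirDeriv_arakawaRows_one_three hf hg (x, y))
  refine ⟨K + 1, by positivity, 1, one_pos, fun dx dy hdx hdx1 hdy hdy1 => ?_⟩
  have h := hb dx ⟨hdx.le, hdx1⟩ dy ⟨hdy.le, hdy1⟩
  rw [dirDeriv_arakawaRows_one_one hf hg] at h
  rw [bilinStencil_arakawaRows_eq f g x y hdx.ne' hdy.ne']
  change |_ - (dirDeriv (1, 0) f (x, y) * dirDeriv (0, 1) g (x, y) -
    dirDeriv (0, 1) f (x, y) * dirDeriv (1, 0) g (x, y))| ≤ _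
  generalize dirDeriv (1, 0) f (x, y) * dirDeriv (0, 1) g (x, y) -
    dirDeriv (0, 1) f (x, y) * dirDeriv (1, 0) g (x, y) = J at h ⊢
  generalize bilinStencil (x, y) f g arakawaRows (dx, dy) = N at h ⊢
  have hpos : 0 < 24 * dx * dy := by positivity
  have hrw : N / (24 * dx * dy) - J = (N - 24 * J * dy * dx) / (24 * dx * dy) := by
    field_simp
  rw [hrw, abs_div, abs_of_pos hpos, div_le_iff₀ hpos]
  refine h.trans ?_
  rw [← sub_nonneg]
  calc (0 : ℝ) ≤ (23 * K + 24) * (dx ^ 2 + dy ^ 2) ^ 2 * dy * dx := by positivity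
    _ = _ := by ring
end
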